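/- arXiv:2507.09661 — 2 statements merged into one kernel-verified Lean document; each statement's English description precedes it below -/
import Mathlib

section
/- Fix i with 1 ≤ i ≤ k and a column index m with 1 ≤ m ≤ n, and for 1 ≤ j ≤ r_i let b_{j,m} denote the m-th column of B_{i,j}. Suppose some b_{j,m} is nonzero, and let l = max{ j : b_{j,m} ≠ 0 }. Then the vectors b_{1,m}, …, b_{l,m} are all nonzero and form a chain of generalized eigenvectors of A corresponding to λ_i ending with an eigenvector: (A − λ_i I) b_{j,m} = b_{j+1,m} for 1 ≤ j ≤ l − 1, and (A − λ_i I) b_{l,m} = 0. -/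
open Matrix Polynomial

/-- A polar part that agrees with a continuous function near the pole vanishes. -/
lemma polar_part_zero {E : Type*} [AddCommGroup E] [Module ℂ E] [TopologicalSpace E]
    [ContinuousSMul ℂ E] [ContinuousAdd E] [T2Space E] (a : ℂ) (g : ℂ → E) (hg : ContinuousAt g a)
    (c : ℕ → E) (r : ℕ)
    (h : ∀ᶠ s in nhdsWithin a {a}ᶜ, ∑ j ∈ Finset.Icc 1 r, ((s - a) ^ j)⁻¹ • c j = g s) :
    ∀ j, 1 ≤ j → j ≤ r → c j = 0 := by
  induction r with
  | zero => intro j h1 h2; omega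
  | succ r ih =>
    have hc : c (r + 1) = 0 := by
      have h1 : Filter.Tendsto (fun s : ℂ => ∑ j ∈ Finset.Icc 1 (r + 1), (s - a) ^ (r + 1 - j) • c j)
          (nhdsWithin a {a}ᶜ) (nhds (c (r + 1))) := by
        have hcont : Continuous
            (fun s : ℂ => ∑ j ∈ Finset.Icc 1 (r + 1), (s - a) ^ (r + 1 - j) • c j) := by
          fun_prop
        have h2 := (hcont.tendsto a).mono_left (nhdsWithin_le_nhds (s := {a}ᶜ))
        convert h2 using 2
        rw [Finset.sum_Icc_succ_top (by omega), Finset.sum_eq_zero]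
        · simp
        · intro j hj
          rw [Finset.mem_Icc] at hj
          rw [sub_self, zero_pow (by omega), zero_smul]
      have h2 : Filter.Tendsto (fun s : ℂ => (s - a) ^ (r + 1) • g s)
          (nhdsWithin a {a}ᶜ) (nhds 0) := by
        have hcont : ContinuousAt (fun s : ℂ => (s - a) ^ (r + 1) • g s) a := by
          fun_prop
        have h3 := hcont.tendsto.mono_left (nhdsWithin_le_nhds (s := {a}ᶜ))
        simpa using h3
      refine tendsto_nhds_unique (h1.congr' ?_) h2
      filter_upwards [h, self_mem_nhdsWithin] with s hs hsa
      have hz : s - a ≠ 0 := sub_ne_zero.mpr hsa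
      rw [← hs, Finset.smul_sum]
      refine Finset.sum_congr rfl fun j hj => ?_
      rw [Finset.mem_Icc] at hj
      rw [smul_smul, pow_sub₀ _ hz hj.2]
    intro j h1 h2
    rcases Nat.lt_or_ge r j with h3 | h3
    · rw [show j = r + 1 by omega, hc]
    · refine ih ?_ j h1 h3
      filter_upwards [h] with s hs
      rw [Finset.sum_Icc_succ_top (by omega), hc, smul_zero, add_zero] at hs
      exact hs

lemma shift_sum {E : Type*} [AddCommGroup E] [Module ℂ E] (z : ℂ) (hz : z ≠ 0) (b : ℕ → E) (r : ℕ) :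
    ∑ j ∈ Finset.Icc 1 r, z • (z ^ j)⁻¹ • b j
      = b 1 + ∑ j ∈ Finset.Icc 1 r, (z ^ j)⁻¹ • b (j + 1) - (z ^ r)⁻¹ • b (r + 1) := by
  induction r with
  | zero => simp
  | succ r ih =>
    rw [Finset.sum_Icc_succ_top (by omega), Finset.sum_Icc_succ_top (by omega), ih]
    have : z • (z ^ (r + 1))⁻¹ • b (r + 1) = (z ^ r)⁻¹ • b (r + 1) := by
      rw [smul_smul]
      congr 1
      field_simp
      ring
    rw [this]
    abel

/-- If `l` is the largest index with the `m`-th column of `B i l` nonzero, then the `m`-th columns of `B i 1, …, B i l` are all nonzero and form a chain of generalized eigenvectors ending with an eigenvector. -/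
theorem chain_of_generalized_eigenvectors
    (n k : ℕ) (hn : 1 ≤ n)
    (A : Matrix (Fin n) (Fin n) ℂ)
    (lam : Fin k → ℂ) (hlam : Function.Injective lam)
    (r : Fin k → ℕ) (hr : ∀ i, 1 ≤ r i)
    (hsum : ∑ i, r i = n)
    (hchar : A.charpoly = ∏ i, (X - C (lam i)) ^ r i)
    (B : Fin k → ℕ → Matrix (Fin n) (Fin n) ℂ)
    (hB : ∀ s : ℂ, (∀ i, s ≠ lam i) →
      (s • (1 : Matrix (Fin n) (Fin n) ℂ) - A)⁻¹
        = ∑ i, ∑ j ∈ Finset.Icc 1 (r i), ((s - lam i) ^ j)⁻¹ • B i j)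
    :
    ∀ i : Fin k, ∀ m : Fin n, ∀ l : ℕ, 1 ≤ l → l ≤ r i →
      (fun p => B i l p m) ≠ 0 →
      (∀ j : ℕ, l < j → j ≤ r i → (fun p => B i j p m) = 0) →
        (∀ j : ℕ, 1 ≤ j → j ≤ l → (fun p => B i j p m) ≠ 0) ∧
        (∀ j : ℕ, 1 ≤ j → j ≤ l - 1 →
          (A - lam i • (1 : Matrix (Fin n) (Fin n) ℂ)).mulVec (fun p => B i j p m)
            = fun p => B i (j + 1) p m) ∧
        (A - lam i • (1 : Matrix (Fin n) (Fin n) ℂ)).mulVec (fun p => B i l p m) = 0 := by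
  intro i m l hl1 hlr hne hmax
  set N := A - lam i • (1 : Matrix (Fin n) (Fin n) ℂ) with hN
  set b : ℕ → Matrix (Fin n) (Fin n) ℂ := fun j => if j ≤ r i then B i j else 0 with hb
  have key : ∀ j, 1 ≤ j → j ≤ r i → b (j + 1) - N * b j = 0 := by
    refine polar_part_zero (lam i) (fun s => 1 - b 1 - (s • (1 : Matrix (Fin n) (Fin n) ℂ) - A) *
      ∑ i' ∈ Finset.univ.erase i, ∑ j ∈ Finset.Icc 1 (r i'), ((s - lam i') ^ j)⁻¹ • B i' j)
      ?_ _ (r i) ?_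
    · refine ContinuousAt.sub continuousAt_const (ContinuousAt.mul (by fun_prop) ?_)
      refine tendsto_finsetSum _ fun i' hi' => tendsto_finsetSum _ fun j hj => ?_
      have hne' : lam i - lam i' ≠ 0 :=
        sub_ne_zero.mpr fun h => (Finset.ne_of_mem_erase hi') (hlam h).symm
      have : ContinuousAt (fun s : ℂ => ((s - lam i') ^ j)⁻¹ • B i' j) (lam i) := by
        have h1 : ContinuousAt (fun s : ℂ => ((s - lam i') ^ j)) (lam i) := by fun_prop
        have h2 : ContinuousAt (fun s : ℂ => ((s - lam i') ^ j)⁻¹) (lam i) :=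
          h1.inv₀ (pow_ne_zero _ hne')
        exact h2.smul continuousAt_const
      exact this
    · have hev : ∀ᶠ s in nhdsWithin (lam i) {lam i}ᶜ, ∀ i', s ≠ lam i' := by
        rw [Filter.eventually_all]
        intro i'
        by_cases h : i' = i
        · subst h
          exact self_mem_nhdsWithin
        · exact nhdsWithin_le_nhds (isOpen_ne.mem_nhds fun h' => h (hlam h').symm)
      filter_upwards [hev] with s hs
      have hz : s - lam i ≠ 0 := sub_ne_zero.mpr (hs i)
      have hdet : IsUnit (s • (1 : Matrix (Fin n) (Fin n) ℂ) - A).det := by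
        have h1 : (s • (1 : Matrix (Fin n) (Fin n) ℂ) - A).det = A.charpoly.eval s := by
          rw [Matrix.eval_charpoly, Matrix.smul_one_eq_diagonal, Matrix.scalar_apply]
        rw [h1, hchar, isUnit_iff_ne_zero, Polynomial.eval_prod, Finset.prod_ne_zero_iff]
        intro i' _
        simpa using fun h => absurd (sub_eq_zero.mp h) (hs i')
      have hmul := Matrix.mul_nonsing_inv _ hdet
      rw [hB s hs, ← Finset.add_sum_erase _ _ (Finset.mem_univ i), mul_add] at hmul
      have hsB : ∑ j ∈ Finset.Icc 1 (r i), ((s - lam i) ^ j)⁻¹ • B i j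
          = ∑ j ∈ Finset.Icc 1 (r i), ((s - lam i) ^ j)⁻¹ • b j := by
        refine Finset.sum_congr rfl fun j hj => ?_
        simp [hb, (Finset.mem_Icc.mp hj).2]
      have hsN : s • (1 : Matrix (Fin n) (Fin n) ℂ) - A = (s - lam i) • 1 - N := by
        rw [hN, sub_smul]; abel
      have h0 : b (r i + 1) = 0 := by simp [hb]
      have hfirst : (s • (1 : Matrix (Fin n) (Fin n) ℂ) - A) *
          ∑ j ∈ Finset.Icc 1 (r i), ((s - lam i) ^ j)⁻¹ • B i j
          = b 1 + ∑ j ∈ Finset.Icc 1 (r i), ((s - lam i) ^ j)⁻¹ • (b (j + 1) - N * b j) := by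
        have h2 := shift_sum (s - lam i) hz b (r i)
        rw [h0, smul_zero, sub_zero] at h2
        rw [hsB, hsN, sub_mul, smul_mul_assoc, one_mul, Finset.smul_sum, h2, Finset.mul_sum]
        simp only [smul_sub, Finset.sum_sub_distrib, mul_smul_comm]
        abel
      rw [hfirst] at hmul
      exact eq_sub_of_add_eq (eq_sub_of_add_eq' (by rw [← add_assoc]; exact hmul))
  have hcol : ∀ j, 1 ≤ j → j ≤ l → N.mulVec (fun p => B i j p m) = fun p => b (j + 1) p m := by
    intro j h1 h2
    have h3 := sub_eq_zero.mp (key j h1 (by omega))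
    rw [h3]
    simp only [hb, if_pos (h2.trans hlr)]
    rfl
  have hchain : ∀ j, 1 ≤ j → j ≤ l - 1 →
      N.mulVec (fun p => B i j p m) = fun p => B i (j + 1) p m := by
    intro j h1 h2
    rw [hcol j h1 (by omega)]
    simp only [hb, if_pos (show j + 1 ≤ r i by omega)]
  refine ⟨?_, hchain, ?_⟩
  · intro j h1 h2 hj
    apply hne
    have : ∀ t, j ≤ t → t ≤ l → (fun p => B i t p m) = 0 := by
      intro t ht
      induction t, ht using Nat.le_induction with
      | base => exact fun _ => hj
      | succ t ht ih =>
        intro htl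
        rw [← hchain t (by omega) (by omega), ih (by omega), Matrix.mulVec_zero]
    exact this l h2 le_rfl
  · rw [hcol l hl1 le_rfl]
    by_cases h : l + 1 ≤ r i
    · simp only [hb, if_pos h]
      exact hmax (l + 1) (by omega) h
    · simp only [hb, if_neg h]
      rfl
end

section
/- For every i with 1 ≤ i ≤ k, the matrix B_{i,1} is idempotent: B_{i,1} · B_{i,1} = B_{i,1}. -/
open Matrix Polynomial

/-- Uniqueness of partial fraction decompositions, scalar version. -/
theorem pf_unique (k : ℕ) (lam : Fin k → ℂ) (hlam : Function.Injective lam)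
    (r : Fin k → ℕ) (c : Fin k → ℕ → ℂ) (D : ℂ)
    (h : ∀ s : ℂ, (∀ i, s ≠ lam i) →
      ∑ i, ∑ j ∈ Finset.Icc 1 (r i), ((s - lam i) ^ j)⁻¹ * c i j = D) :
    D = 0 ∧ ∀ i, ∀ j ∈ Finset.Icc 1 (r i), c i j = 0 := by
  classical
  set f : Fin k → ℂ[X] := fun i =>
    ∑ j ∈ Finset.Icc 1 (r i), C (c i j) * (X - C (lam i)) ^ (r i - j) with hf
  set Q : Fin k → ℂ[X] := fun i =>
    ∏ l ∈ Finset.univ.erase i, (X - C (lam l)) ^ (r l) with hQ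
  set q : ℂ[X] := ∏ l, (X - C (lam l)) ^ (r l) with hq
  have hqQ : ∀ i, q = (X - C (lam i)) ^ r i * Q i := fun i =>
    (Finset.mul_prod_erase _ _ (Finset.mem_univ i)).symm
  have hinf : (Set.range lam)ᶜ.Infinite := (Set.finite_range lam).infinite_compl
  have hpoly : ∑ i, f i * Q i = C D * q := by
    refine Polynomial.eq_of_infinite_eval_eq _ _ (hinf.mono ?_)
    intro s hs
    have hs' : ∀ i, s ≠ lam i := fun i hi => hs ⟨i, hi.symm⟩
    simp only [Set.mem_ofPred_eq]
    rw [eval_mul, eval_C, ← h s hs', eval_finsetSum, Finset.sum_mul]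
    refine Finset.sum_congr rfl fun i _ => ?_
    rw [hqQ i, eval_mul, eval_mul, ← mul_assoc]
    congr 1
    simp only [hf, eval_finsetSum, Finset.sum_mul]
    refine Finset.sum_congr rfl fun j hj => ?_
    have hj2 := (Finset.mem_Icc.1 hj).2
    have hne : s - lam i ≠ 0 := sub_ne_zero.2 (hs' i)
    simp only [eval_mul, eval_C, eval_pow, eval_sub, eval_X]
    rw [pow_sub₀ _ hne hj2]
    ring
  have hf0 : ∀ i, f i = 0 := by
    intro i
    have hdvd : (X - C (lam i)) ^ r i ∣ f i * Q i := by
      have h1 : f i * Q i = C D * q - ∑ l ∈ Finset.univ.erase i, f l * Q l := by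
        rw [← hpoly, ← Finset.add_sum_erase _ _ (Finset.mem_univ i)]; ring
      rw [h1]
      refine dvd_sub (Dvd.dvd.mul_left ⟨_, hqQ i⟩ _) (Finset.dvd_sum fun l hl => ?_)
      refine Dvd.dvd.mul_left (Finset.dvd_prod_of_mem (fun l => (X - C (lam l)) ^ (r l)) ?_) _
      simp only [Finset.mem_erase, Finset.mem_univ, and_true] at hl ⊢
      exact fun h => hl h.symm
    have hcop : IsCoprime ((X - C (lam i)) ^ r i) (Q i) := by
      refine IsCoprime.prod_right fun l hl => IsCoprime.pow ?_
      refine Polynomial.isCoprime_X_sub_C_of_isUnit_sub ?_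
      refine IsUnit.mk0 _ (sub_ne_zero.2 fun h => ?_)
      exact (Finset.mem_erase.1 hl).1 (hlam h).symm
    have hd := hcop.dvd_of_dvd_mul_right hdvd
    by_contra hne
    have hmon : ((X - C (lam i)) ^ r i).Monic := (monic_X_sub_C _).pow _
    refine hne (Polynomial.eq_zero_of_dvd_of_degree_lt hd ?_)
    rw [degree_pow, degree_X_sub_C, nsmul_one]
    refine lt_of_le_of_lt (degree_sum_le _ _) ?_
    rw [Finset.sup_lt_iff (WithBot.bot_lt_coe _)]
    intro j hj
    have hj2 := Finset.mem_Icc.1 hj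
    rw [← smul_eq_C_mul]
    refine lt_of_le_of_lt (degree_smul_le _ _) ?_
    rw [degree_pow, degree_X_sub_C, nsmul_one]
    exact_mod_cast (by omega : r i - j < r i)
  constructor
  · have hq0 : q ≠ 0 := (monic_prod_of_monic _ _ fun l _ => (monic_X_sub_C _).pow _).ne_zero
    simp only [hf0, zero_mul, Finset.sum_const_zero] at hpoly
    have := (mul_eq_zero.1 hpoly.symm).resolve_right hq0
    simpa using this
  · intro i j hj
    have h1 : (f i).comp (X + C (lam i)) = 0 := by rw [hf0 i, zero_comp]
    have h2 : (f i).comp (X + C (lam i)) =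
        ∑ j ∈ Finset.Icc 1 (r i), C (c i j) * X ^ (r i - j) := by
      simp [hf]
    rw [h2] at h1
    have h3 := congrArg (fun p => coeff p (r i - j)) h1
    simp only [finsetSum_coeff, coeff_C_mul, coeff_X_pow, coeff_zero] at h3
    rw [Finset.sum_eq_single j] at h3
    · simpa using h3
    · intro b hb hbj
      have := Finset.mem_Icc.1 hb
      have := Finset.mem_Icc.1 hj
      rw [if_neg (by omega), mul_zero]
    · exact fun h => absurd hj h

theorem pf_unique_matrix (n k : ℕ) (lam : Fin k → ℂ) (hlam : Function.Injective lam)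
    (r : Fin k → ℕ) (c : Fin k → ℕ → Matrix (Fin n) (Fin n) ℂ) (D : Matrix (Fin n) (Fin n) ℂ)
    (h : ∀ s : ℂ, (∀ i, s ≠ lam i) →
      ∑ i, ∑ j ∈ Finset.Icc 1 (r i), ((s - lam i) ^ j)⁻¹ • c i j = D) :
    D = 0 ∧ ∀ i, ∀ j ∈ Finset.Icc 1 (r i), c i j = 0 := by
  have key := fun a b => pf_unique k lam hlam r (fun i j => c i j a b) (D a b) (by
    intro s hs
    rw [← h s hs]
    simp [Matrix.sum_apply])
  constructor
  · ext a b; exact (key a b).1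
  · intro i j hj; ext a b; exact (key a b).2 i j hj

theorem tele {M : Type*} [AddCommGroup M] [Module ℂ M] (x : ℂ) (hx : x ≠ 0) (m : ℕ) (b : ℕ → M) :
    ∑ j ∈ Finset.Icc 1 m, (x ^ j)⁻¹ • (x • b j) + (x ^ m)⁻¹ • b (m + 1) =
      b 1 + ∑ j ∈ Finset.Icc 1 m, (x ^ j)⁻¹ • b (j + 1) := by
  induction m with
  | zero => simp
  | succ m ih =>
    rw [Finset.sum_Icc_succ_top (by omega), Finset.sum_Icc_succ_top (by omega), ← add_assoc, ← ih]
    have : (x ^ (m + 1))⁻¹ • (x • b (m + 1)) = (x ^ m)⁻¹ • b (m + 1) := by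
      rw [smul_smul]; congr 1; field_simp; ring
    rw [this]

/-- `B i 1` is idempotent. -/
theorem leading_projector_idempotent
    (n k : ℕ) (hn : 1 ≤ n)
    (A : Matrix (Fin n) (Fin n) ℂ)
    (lam : Fin k → ℂ) (hlam : Function.Injective lam)
    (r : Fin k → ℕ) (hr : ∀ i, 1 ≤ r i)
    (hsum : ∑ i, r i = n)
    (hchar : A.charpoly = ∏ i, (X - C (lam i)) ^ r i)
    (B : Fin k → ℕ → Matrix (Fin n) (Fin n) ℂ)
    (hB : ∀ s : ℂ, (∀ i, s ≠ lam i) →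
      (s • (1 : Matrix (Fin n) (Fin n) ℂ) - A)⁻¹
        = ∑ i, ∑ j ∈ Finset.Icc 1 (r i), ((s - lam i) ^ j)⁻¹ • B i j)
    :
    ∀ i : Fin k, B i 1 * B i 1 = B i 1 := by
  classical
  have hdet : ∀ s : ℂ, (∀ i, s ≠ lam i) →
      IsUnit (s • (1 : Matrix (Fin n) (Fin n) ℂ) - A).det := by
    intro s hs
    have h1 := Matrix.eval_charpoly A s
    have h2 : Matrix.scalar (Fin n) s = s • (1 : Matrix (Fin n) (Fin n) ℂ) := by
      rw [Matrix.scalar_apply, Matrix.smul_one_eq_diagonal]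
    rw [← h2, ← h1, hchar, eval_prod]
    refine IsUnit.mk0 _ (Finset.prod_ne_zero_iff.2 fun i _ => ?_)
    simpa using fun h => absurd (sub_eq_zero.1 h) (hs i)
  set b : Fin k → ℕ → Matrix (Fin n) (Fin n) ℂ := fun i j => if j ≤ r i then B i j else 0 with hb
  have hb1 : ∀ i, b i 1 = B i 1 := fun i => if_pos (hr i)
  have hbtop : ∀ i, b i (r i + 1) = 0 := fun i => if_neg (by omega)
  have hBb : ∀ s : ℂ, (∀ i, s ≠ lam i) →
      (s • (1 : Matrix (Fin n) (Fin n) ℂ) - A)⁻¹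
        = ∑ i, ∑ j ∈ Finset.Icc 1 (r i), ((s - lam i) ^ j)⁻¹ • b i j := by
    intro s hs
    rw [hB s hs]
    refine Finset.sum_congr rfl fun i _ => Finset.sum_congr rfl fun j hj => ?_
    rw [hb]; simp only [if_pos (Finset.mem_Icc.1 hj).2]
  have htele : ∀ s : ℂ, (∀ i, s ≠ lam i) → ∀ i,
      ∑ j ∈ Finset.Icc 1 (r i), ((s - lam i) ^ j)⁻¹ • ((s - lam i) • b i j) =
      b i 1 + ∑ j ∈ Finset.Icc 1 (r i), ((s - lam i) ^ j)⁻¹ • b i (j + 1) := by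
    intro s hs i
    rw [← tele _ (sub_ne_zero.2 (hs i)), hbtop, smul_zero, add_zero]
  set N : Fin k → Matrix (Fin n) (Fin n) ℂ := fun i => A - lam i • 1 with hN
  have hsA : ∀ s i, s • (1 : Matrix (Fin n) (Fin n) ℂ) - A = (s - lam i) • 1 - N i := by
    intro s i; simp only [hN, sub_smul]; abel
  obtain ⟨hone, hleft⟩ := pf_unique_matrix n k lam hlam r
    (fun i j => b i (j + 1) - N i * b i j) (1 - ∑ i, b i 1) (by
      intro s hs
      have h1 := Matrix.mul_nonsing_inv _ (hdet s hs)
      rw [hBb s hs, Finset.mul_sum] at h1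
      rw [← h1, ← Finset.sum_sub_distrib]
      refine Finset.sum_congr rfl fun i _ => ?_
      rw [hsA s i, eq_sub_iff_add_eq', Finset.mul_sum]
      simp only [smul_sub, Finset.sum_sub_distrib, sub_mul, Matrix.mul_smul, Matrix.smul_mul,
        one_mul]
      rw [← add_sub_assoc, ← htele s hs i])
  obtain ⟨-, hright⟩ := pf_unique_matrix n k lam hlam r
    (fun i j => b i (j + 1) - b i j * N i) (1 - ∑ i, b i 1) (by
      intro s hs
      have h1 := Matrix.nonsing_inv_mul _ (hdet s hs)
      rw [hBb s hs, Finset.sum_mul] at h1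
      rw [← h1, ← Finset.sum_sub_distrib]
      refine Finset.sum_congr rfl fun i _ => ?_
      rw [hsA s i, eq_sub_iff_add_eq', Finset.sum_mul]
      simp only [smul_sub, Finset.sum_sub_distrib, mul_sub, Matrix.mul_smul, Matrix.smul_mul,
        mul_one]
      rw [← add_sub_assoc, ← htele s hs i]
      simp only [smul_comm (s - lam i)])
  have hpow : ∀ i m, m ≤ r i → b i (m + 1) = N i ^ m * b i 1 := by
    intro i m
    induction m with
    | zero => simp
    | succ m ih =>
      intro hm
      have := hleft i (m + 1) (Finset.mem_Icc.2 ⟨by omega, hm⟩)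
      rw [sub_eq_zero.1 this, ih (by omega), pow_succ', mul_assoc]
  have hnil : ∀ i, N i ^ r i * b i 1 = 0 := fun i => by rw [← hpow i _ le_rfl, hbtop]
  have hcomm : ∀ i, Commute A (b i 1) := by
    intro i
    have hm : 1 ∈ Finset.Icc 1 (r i) := Finset.mem_Icc.2 ⟨le_rfl, hr i⟩
    have h1 := hleft i 1 hm
    have h2 := hright i 1 hm
    have h3 : N i * b i 1 = b i 1 * N i := (sub_eq_zero.1 h1).symm.trans (sub_eq_zero.1 h2)
    simp only [hN, sub_mul, mul_sub, Matrix.smul_mul, Matrix.mul_smul, one_mul, mul_one] at h3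
    exact sub_left_injective h3
  have hNae : ∀ i, aeval A ((X - C (lam i)) ^ r i) = N i ^ r i := by
    intro i; simp [hN, Algebra.algebraMap_eq_smul_one]
  have horth : ∀ i l, i ≠ l → b i 1 * b l 1 = 0 := by
    intro i l hil
    have hcop : IsCoprime ((X - C (lam i)) ^ r i) ((X - C (lam l)) ^ r l) := by
      refine IsCoprime.pow (Polynomial.isCoprime_X_sub_C_of_isUnit_sub ?_)
      exact IsUnit.mk0 _ (sub_ne_zero.2 fun h => hil (hlam h))
    obtain ⟨u, v, huv⟩ := hcop
    have h1 := congrArg (aeval A) huv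
    rw [map_add, map_mul, map_mul, hNae, hNae, map_one] at h1
    have hc : Commute (N l ^ r l) (b i 1) := by
      refine Commute.pow_left ?_ _
      exact (hcomm i).sub_left ((Commute.one_left _).smul_left _)
    calc b i 1 * b l 1 = (aeval A u * N i ^ r i + aeval A v * N l ^ r l) * (b i 1 * b l 1) := by
          rw [h1, one_mul]
      _ = aeval A u * (N i ^ r i * b i 1) * b l 1 + aeval A v * (N l ^ r l * b i 1) * b l 1 := by
          simp only [add_mul, mul_assoc]
      _ = 0 := by
          rw [hnil, hc.eq]; simp only [mul_assoc, hnil]; simp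
  intro i
  rw [← hb1 i]
  have h1 : b i 1 * ∑ l, b l 1 = b i 1 := by rw [← sub_eq_zero.1 hone, mul_one]
  rw [Finset.mul_sum, Finset.sum_eq_single i (fun l _ hl => horth i l hl.symm)
    (fun h => absurd (Finset.mem_univ i) h)] at h1
  exact h1
end
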